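/- (Correctness of the 2-hop labeling distance query.) Let s, t ∈ V and suppose the 2-hop labeling satisfies the cover property for the pair (s, t). Then dis(s, t) = ⨅_{u ∈ L_out(s) ∩ L_in(t)} (dis(s, u) + dis(u, t)); i.e., the least cost from s to t equals the minimum, over vertices common to L_out(s) and L_in(t), of the sum of the stored distances. -/

import Mathlib

open scoped ENNReal

noncomputable def routeCost {V : Type*} (W : V → V → ℝ≥0∞) : List V → ℝ≥0∞
  | [] => 0
  | [_] => 0
  | u :: v :: rest => W u v + routeCost W (v :: rest)

/-- The least cost from `u` to `v`: the infimum, over all routes (nonempty vertex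
lists starting at `u` and ending at `v`), of their costs. -/
noncomputable def dis {V : Type*} (W : V → V → ℝ≥0∞) (u v : V) : ℝ≥0∞ :=
  ⨅ l ∈ {l : List V | l.head? = some u ∧ l.getLast? = some v}, routeCost W l

/-- The cost of a route splits at each of its vertices. -/
theorem routeCost_append_cons {V : Type*} (W : V → V → ℝ≥0∞) (l r : List V) (u : V) :
    routeCost W (l ++ u :: r) = routeCost W (l ++ [u]) + routeCost W (u :: r) := by
  induction l with
  | nil => simp [routeCost]
  | cons a l ih =>
    cases l with
    | nil => simp [routeCost]
    | cons b l =>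
      simp only [List.cons_append, routeCost] at ih ⊢
      rw [ih, add_assoc]

theorem dis_le_routeCost {V : Type*} (W : V → V → ℝ≥0∞) {u v : V} {l : List V}
    (hu : l.head? = some u) (hv : l.getLast? = some v) : dis W u v ≤ routeCost W l :=
  iInf₂_le l ⟨hu, hv⟩

theorem dis_triangle {V : Type*} (W : V → V → ℝ≥0∞) (s u t : V) :
    dis W s t ≤ dis W s u + dis W u t := by
  refine ENNReal.le_iInf₂_add_iInf₂ ?_
  rintro l₁ ⟨hs, hu⟩ l₂ ⟨hu', ht⟩
  obtain ⟨l, rfl⟩ := List.getLast?_eq_some_iff.mp hu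
  obtain ⟨r, rfl⟩ := List.head?_eq_some_iff.mp hu'
  rw [← routeCost_append_cons]
  refine dis_le_routeCost W ?_ ?_
  · cases l <;> simpa using hs
  · rw [List.getLast?_append, ht, Option.some_or]

/-- Correctness of the 2-hop labeling distance query: if the labeling
satisfies the cover property for the pair `(s, t)`, then the least cost from `s`
to `t` equals the minimum, over vertices common to `L_out(s)` and `L_in(t)`, of the
sum of the stored distances. -/
theorem two_hop_query_correct {V : Type*} (W : V → V → ℝ≥0∞)
    (Lout Lin : V → Set V) (s t : V)
    (hcover : ∃ u ∈ Lout s ∩ Lin t, dis W s u + dis W u t = dis W s t) :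
    dis W s t = ⨅ u ∈ Lout s ∩ Lin t, (dis W s u + dis W u t) := by
  obtain ⟨u, hu, h⟩ := hcover
  exact le_antisymm (le_iInf₂ fun v _ => dis_triangle W s v t) (h ▸ iInf₂_le u hu)
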